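/- Let D₈ = ⟨r, s ∣ r⁴ = 1, s² = 1, s r s⁻¹ = r⁻¹⟩ be the dihedral group of order 8, and let φ : D₈ → GL₂(𝔽₃) be the homomorphism sending r to the matrix [[0, −1], [1, 0]] and s to the matrix [[1, 0], [0, −1]]. Let G := (C₃ × C₃) ⋊_φ D₈ be the semidirect product of the additive group 𝔽₃² by D₈ acting via φ. Then G has trivial center, while the maximal 2-step solvable quotient G/G^(2) (the quotient by the second derived subgroup) is isomorphic to D₈ and has nontrivial center. -/

import Mathlib

instance derivedSeries_normal' (G : Type*) [Group G] (n : ℕ) : (derivedSeries G n).Normal :=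
  derivedSeries_normal G n

open SemidirectProduct commutatorElement in
/-- If `z` lies in the `n`-th derived subgroup of `H` and acts on `N` by inversion, where `N` has
exponent dividing three, then `N` lies in the `(n + 1)`-st derived subgroup of `N ⋊ H`. -/
theorem SemidirectProduct.inl_mem_derivedSeries {N H : Type*} [Group N] [Group H]
    {ψ : H →* MulAut N} {z : H} (hz : ∀ w, ψ z w = w⁻¹) (hN : ∀ w : N, w ^ 3 = 1) {n : ℕ}
    (hn : z ∈ derivedSeries H n) (w : N) :
    (inl w : N ⋊[ψ] H) ∈ derivedSeries (N ⋊[ψ] H) (n + 1) := by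
  have hc : ⁅(inr z : N ⋊[ψ] H), (inl w : N ⋊[ψ] H)⁆ = inl w := by
    have h3 : w⁻¹ * w⁻¹ = w := by
      rw [← mul_inv_rev, inv_eq_iff_mul_eq_one, ← pow_two, ← pow_succ, hN]
    rw [commutatorElement_def, ← map_inv inr, ← inl_aut, hz, ← map_inv, ← map_mul, h3]
  have hz' {m : ℕ} (hm : z ∈ derivedSeries H m) :
      (inr z : N ⋊[ψ] H) ∈ derivedSeries (N ⋊[ψ] H) m :=
    map_derivedSeries_le_derivedSeries (inr : H →* N ⋊[ψ] H) m
      (Subgroup.mem_map_of_mem inr hm)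
  have step {m : ℕ} (hm : z ∈ derivedSeries H m)
      (hw : (inl w : N ⋊[ψ] H) ∈ derivedSeries (N ⋊[ψ] H) m) :
      (inl w : N ⋊[ψ] H) ∈ derivedSeries (N ⋊[ψ] H) (m + 1) := by
    have h := Subgroup.commutator_mem_commutator (hz' hm) hw
    rwa [hc] at h
  induction n with
  | zero => exact step hn (Subgroup.mem_top _)
  | succ n ih => exact step hn (ih (derivedSeries_antitone (G := H) n.le_succ hn))

namespace DihedralGroup

theorem r_two_mem_derivedSeries_one : (r 2 : DihedralGroup 4) ∈ derivedSeries _ 1 := by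
  have h := Subgroup.commutator_mem_commutator (Subgroup.mem_top (r 1 : DihedralGroup 4))
    (Subgroup.mem_top (sr 0))
  exact h

theorem derivedSeries_two_eq_bot (n : ℕ) : derivedSeries (DihedralGroup n) 2 = ⊥ := by
  have h1 : ∀ x ∈ derivedSeries (DihedralGroup n) 1, ∃ i, x = r i := by
    intro x hx
    rw [derivedSeries_one, commutator_def, Subgroup.commutator_def] at hx
    induction hx using Subgroup.closure_induction with
    | mem x hx =>
      obtain ⟨a, -, b, -, rfl⟩ := hx
      rcases a with i | i <;> rcases b with j | j
      · exact ⟨i + j + -i + -j, rfl⟩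
      all_goals simp [commutatorElement_def]
    | one => exact ⟨0, rfl⟩
    | mul x y _ _ hx hy =>
      obtain ⟨⟨i, rfl⟩, j, rfl⟩ := And.intro hx hy
      exact ⟨i + j, rfl⟩
    | inv x _ hx =>
      obtain ⟨i, rfl⟩ := hx
      exact ⟨-i, rfl⟩
  rw [derivedSeries_succ, Subgroup.commutator_eq_bot_iff_le_centralizer]
  intro x hx
  rw [Subgroup.mem_centralizer_iff]
  intro y hy
  obtain ⟨⟨i, rfl⟩, j, rfl⟩ := And.intro (h1 x hx) (h1 y hy)
  simp [add_comm]

end DihedralGroup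

/-- Let `D₈` be the dihedral group of order 8 with rotation `r` of order 4
and reflection `s`, and let `φ : D₈ → GL₂(𝔽₃)` send `r ↦ [[0,-1],[1,0]]` and
`s ↦ [[1,0],[0,-1]]`. Let `G := 𝔽₃² ⋊_φ D₈` be the corresponding semidirect product (here
`ψ` is the action of `D₈` on the additive group `𝔽₃²` by the matrices above, i.e. for a
vector `v`, `r` acts by `v ↦ (-v₁, v₀)` and `s` by `v ↦ (v₀, -v₁)`). Then `G` has trivial
center, while its maximal 2-step solvable quotient `G/G⁽²⁾` is isomorphic to `D₈`, which
has nontrivial center. -/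
theorem stmt6
    (ψ : DihedralGroup 4 →* MulAut (Multiplicative (Fin 2 → ZMod 3)))
    (hr : ∀ v : Fin 2 → ZMod 3,
      Multiplicative.toAdd (ψ (DihedralGroup.r 1) (Multiplicative.ofAdd v)) = ![-(v 1), v 0])
    (hs : ∀ v : Fin 2 → ZMod 3,
      Multiplicative.toAdd (ψ (DihedralGroup.sr 0) (Multiplicative.ofAdd v)) = ![v 0, -(v 1)]) :
    Subgroup.center (Multiplicative (Fin 2 → ZMod 3) ⋊[ψ] DihedralGroup 4) = ⊥ ∧
    Nonempty
      (((Multiplicative (Fin 2 → ZMod 3) ⋊[ψ] DihedralGroup 4) ⧸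
          derivedSeries (Multiplicative (Fin 2 → ZMod 3) ⋊[ψ] DihedralGroup 4) 2) ≃*
        DihedralGroup 4) ∧
    Subgroup.center
        ((Multiplicative (Fin 2 → ZMod 3) ⋊[ψ] DihedralGroup 4) ⧸
          derivedSeries (Multiplicative (Fin 2 → ZMod 3) ⋊[ψ] DihedralGroup 4) 2) ≠ ⊥ := by
  have hz : ∀ w, ψ (DihedralGroup.r 2) w = w⁻¹ := by
    intro w
    have h2 : (DihedralGroup.r 2 : DihedralGroup 4) = DihedralGroup.r 1 * DihedralGroup.r 1 := rfl
    apply Multiplicative.toAdd.injective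
    rw [h2, map_mul, MulAut.mul_apply]
    have h := hr (Multiplicative.toAdd w)
    have h' := hr (Multiplicative.toAdd (ψ (DihedralGroup.r 1) w))
    rw [ofAdd_toAdd] at h h'
    rw [h', h]
    ext i
    fin_cases i <;> simp
  have hN : ∀ w : Multiplicative (Fin 2 → ZMod 3), w ^ 3 = 1 := by
    intro w
    apply Multiplicative.toAdd.injective
    ext i
    rw [toAdd_pow, Pi.smul_apply, nsmul_eq_mul]
    exact (congrArg (· * _) (ZMod.natCast_self 3)).trans (zero_mul _)
  have hinv : ∀ w : Multiplicative (Fin 2 → ZMod 3), w⁻¹ = w → w = 1 := by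
    intro w hw
    have h := hN w
    rwa [pow_succ, pow_two, mul_eq_one_iff_inv_eq.mpr hw, one_mul] at h
  have hD : derivedSeries (Multiplicative (Fin 2 → ZMod 3) ⋊[ψ] DihedralGroup 4) 2 =
      (SemidirectProduct.rightHom (φ := ψ)).ker := by
    apply le_antisymm
    · have h := map_derivedSeries_le_derivedSeries (SemidirectProduct.rightHom (φ := ψ)) 2
      rwa [DihedralGroup.derivedSeries_two_eq_bot, le_bot_iff, Subgroup.map_eq_bot_iff] at h
    · rw [← SemidirectProduct.range_inl_eq_ker_rightHom]
      rintro _ ⟨w, rfl⟩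
      exact SemidirectProduct.inl_mem_derivedSeries hz hN
        DihedralGroup.r_two_mem_derivedSeries_one w
  have e : (Multiplicative (Fin 2 → ZMod 3) ⋊[ψ] DihedralGroup 4) ⧸
      derivedSeries (Multiplicative (Fin 2 → ZMod 3) ⋊[ψ] DihedralGroup 4) 2 ≃*
        DihedralGroup 4 :=
    (QuotientGroup.quotientMulEquivOfEq hD).trans
      (QuotientGroup.quotientKerEquivOfSurjective _ SemidirectProduct.rightHom_surjective)
  refine ⟨?_, ⟨e⟩, ?_⟩
  · rw [eq_bot_iff]
    rintro ⟨v, g⟩ hx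
    rw [Subgroup.mem_center_iff] at hx
    have hv : v = 1 := by
      have h := congrArg SemidirectProduct.left (hx (SemidirectProduct.inr (DihedralGroup.r 2)))
      simp [hz] at h
      exact hinv v h
    have hg : ∀ k, k * g = g * k := fun k =>
      congrArg SemidirectProduct.right (hx (SemidirectProduct.inr k))
    have hg' : g = 1 ∨ g = DihedralGroup.r 2 := by
      clear hx
      revert g
      decide
    subst hv
    obtain rfl | rfl := hg'
    · rfl
    · exfalso
      have h := congrArg SemidirectProduct.left
        (hx (SemidirectProduct.inl (Multiplicative.ofAdd ![1, 0])))
      simp [hz] at h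
      have h0 := hinv _ h.symm
      have h1 : (1 : ZMod 3) = 0 := congrFun (congrArg Multiplicative.toAdd h0) 0
      exact absurd h1 (by decide)
  · intro h
    have hc : e.symm (DihedralGroup.r 2) ∈ Subgroup.center
        ((Multiplicative (Fin 2 → ZMod 3) ⋊[ψ] DihedralGroup 4) ⧸
          derivedSeries (Multiplicative (Fin 2 → ZMod 3) ⋊[ψ] DihedralGroup 4) 2) := by
      rw [Subgroup.mem_center_iff]
      intro x
      apply e.injective
      rw [map_mul, map_mul, e.apply_symm_apply]
      generalize e x = y
      revert y
      decide
    rw [h, Subgroup.mem_bot, map_eq_one_iff e.symm e.symm.injective] at hc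
    exact absurd hc (by decide)
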